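/- Let Ξ = 𝓛 + U be the stationarized lattice, where U is uniform on the fundamental domain 𝒟 of the full-rank lattice 𝓛 ⊂ ℝ^d. Then Ξ is class I hyperuniform: Var(#(Ξ ∩ B_r))/λ^d(B_r) = O(r^{-1}) as r → ∞; equivalently, Var(#((𝓛 + U) ∩ B_r)) = O(r^{d−1}). -/

import Mathlib

open MeasureTheory ProbabilityTheory Filter Asymptotics

noncomputable section



lemma hu_deriv_cos (u : ℝ → ℝ) (hu : Continuous u) (s : ℝ) :
    HasDerivAt (fun s => ∫ t in (-1:ℝ)..1, u t * Real.cos (s * t))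
      (-∫ t in (-1:ℝ)..1, (u t * t) * Real.sin (s * t)) s := by
  have h := (intervalIntegral.hasDerivAt_integral_of_dominated_loc_of_deriv_le (μ := volume)
    (a := -1) (b := 1) (F := fun s t => u t * Real.cos (s * t))
    (F' := fun s t => -((u t * t) * Real.sin (s * t))) (x₀ := s) (s := Set.univ)
    (bound := fun t => |u t * t|) Filter.univ_mem ?_ ?_ ?_ ?_ ?_ ?_).2
  · simpa only [intervalIntegral.integral_neg] using h
  · exact Eventually.of_forall fun x => (by fun_prop : Continuous _).aestronglyMeasurable
  · exact (by fun_prop : Continuous _).intervalIntegrable _ _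
  · exact (by fun_prop : Continuous _).aestronglyMeasurable
  · refine Eventually.of_forall fun t _ x _ => ?_
    rw [norm_neg, Real.norm_eq_abs, abs_mul]
    exact mul_le_of_le_one_right (abs_nonneg _) (Real.abs_sin_le_one _)
  · exact (by fun_prop : Continuous _).intervalIntegrable _ _
  · refine Eventually.of_forall fun t _ x _ => ?_
    have := (((hasDerivAt_id x).mul_const t).cos).const_mul (u t)
    refine this.congr_deriv ?_
    simp; try ring

lemma hu_deriv_sin (u : ℝ → ℝ) (hu : Continuous u) (s : ℝ) :
    HasDerivAt (fun s => ∫ t in (-1:ℝ)..1, u t * Real.sin (s * t))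
      (∫ t in (-1:ℝ)..1, (u t * t) * Real.cos (s * t)) s := by
  have h := (intervalIntegral.hasDerivAt_integral_of_dominated_loc_of_deriv_le (μ := volume)
    (a := -1) (b := 1) (F := fun s t => u t * Real.sin (s * t))
    (F' := fun s t => ((u t * t) * Real.cos (s * t))) (x₀ := s) (s := Set.univ)
    (bound := fun t => |u t * t|) Filter.univ_mem ?_ ?_ ?_ ?_ ?_ ?_).2
  · exact h
  · exact Eventually.of_forall fun x => (by fun_prop : Continuous _).aestronglyMeasurable
  · exact (by fun_prop : Continuous _).intervalIntegrable _ _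
  · exact (by fun_prop : Continuous _).aestronglyMeasurable
  · refine Eventually.of_forall fun t _ x _ => ?_
    rw [Real.norm_eq_abs, abs_mul]
    exact mul_le_of_le_one_right (abs_nonneg _) (Real.abs_cos_le_one _)
  · exact (by fun_prop : Continuous _).intervalIntegrable _ _
  · refine Eventually.of_forall fun t _ x _ => ?_
    have := (((hasDerivAt_id x).mul_const t).sin).const_mul (u t)
    refine this.congr_deriv ?_
    simp; try ring

def huw (n : ℕ) (t : ℝ) : ℝ := (√(1 - t ^ 2)) ^ n

lemma huw_cont (n : ℕ) : Continuous (huw n) := by unfold huw; fun_prop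

/-- the Bessel ODE -/
lemma hu_ode (n : ℕ) (s : ℝ) :
    s * (∫ t in (-1:ℝ)..1, huw n t * Real.cos (s * t))
    - (n + 2) * (∫ t in (-1:ℝ)..1, (huw n t * t) * Real.sin (s * t))
    - s * (∫ t in (-1:ℝ)..1, (huw n t * t * t) * Real.cos (s * t)) = 0 := by
  have hc := huw_cont n
  have h1 : ∫ t in (-1:ℝ)..1, (s * (huw n t * Real.cos (s * t))
      - (n + 2) * ((huw n t * t) * Real.sin (s * t))
      - s * ((huw n t * t * t) * Real.cos (s * t))) =
      (√(1 - (1:ℝ) ^ 2)) ^ (n+2) * Real.sin (s * 1)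
      - (√(1 - (-1:ℝ) ^ 2)) ^ (n+2) * Real.sin (s * (-1)) := by
    refine intervalIntegral.integral_eq_sub_of_hasDerivAt_of_le
      (f := fun t => (√(1 - t ^ 2)) ^ (n+2) * Real.sin (s * t)) (by norm_num)
      (by fun_prop) ?_ ((by fun_prop : Continuous _).intervalIntegrable _ _)
    intro t ht
    have hpos : 0 < 1 - t ^ 2 := by nlinarith [ht.1, ht.2]
    have d1 : HasDerivAt (fun t : ℝ => 1 - t ^ 2) (-(2 * t)) t := by
      simpa using ((hasDerivAt_pow 2 t).const_sub 1)
    have d2 := ((d1.sqrt hpos.ne').pow (n + 2)).mul (((hasDerivAt_id t).const_mul s).sin)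
    refine d2.congr_deriv ?_
    have hsq : √(1 - t ^ 2) ^ 2 = 1 - t ^ 2 := Real.sq_sqrt hpos.le
    have hs0 : √(1 - t ^ 2) ≠ 0 := (Real.sqrt_pos.2 hpos).ne'
    simp only [huw, Pi.pow_apply, id, Nat.add_sub_cancel]
    have e1 : (n + 2 - 1) = n + 1 := by omega
    rw [e1, pow_add _ n 2, hsq, pow_succ]
    push_cast
    field_simp
    ring
  rw [intervalIntegral.integral_sub, intervalIntegral.integral_sub,
    intervalIntegral.integral_const_mul, intervalIntegral.integral_const_mul,
    intervalIntegral.integral_const_mul] at h1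
  · rw [h1]; norm_num
  all_goals exact (by fun_prop : Continuous _).intervalIntegrable _ _

lemma hu_decay1 (n : ℕ) : ∃ C : ℝ, 0 ≤ C ∧ ∀ s : ℝ, 0 < s →
    s ^ (n + 2) * (∫ t in (-1:ℝ)..1, huw n t * Real.cos (s * t)) ^ 2 ≤ C := by
  set g : ℝ → ℝ := fun s => ∫ t in (-1:ℝ)..1, huw n t * Real.cos (s * t) with hg
  set g1 : ℝ → ℝ := fun s => -∫ t in (-1:ℝ)..1, (huw n t * t) * Real.sin (s * t) with hg1
  set g2 : ℝ → ℝ := fun s => -∫ t in (-1:ℝ)..1, (huw n t * t * t) * Real.cos (s * t) with hg2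
  have hc := huw_cont n
  have D1 : ∀ s, HasDerivAt g (g1 s) s := fun s => hu_deriv_cos _ hc s
  have D2 : ∀ s, HasDerivAt g1 (g2 s) s := fun s =>
    (hu_deriv_sin (fun t => huw n t * t) (by fun_prop) s).neg
  have ode : ∀ s, s * g s + (n + 2) * g1 s + s * g2 s = 0 := by
    intro s; have := hu_ode n s; simp only [hg, hg1, hg2]; linarith
  set p : ℝ := (n + 2) / 2 with hp
  set q : ℝ := p * (p - 1) with hq
  have hn : (0:ℝ) ≤ n := n.cast_nonneg
  have hq0 : 0 ≤ q := mul_nonneg (by positivity) (by rw [hp]; linarith)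
  set E : ℝ → ℝ := fun s => s ^ (n + 2) * (g s ^ 2 + (g1 s + p * (g s / s)) ^ 2) with hE
  have DE : ∀ s, 0 < s → HasDerivAt E
      (s ^ (n + 2) * (2 * q / s ^ 2 * (g s * (g1 s + p * (g s / s))))) s := by
    intro s hs
    have h1 := (hasDerivAt_pow (n+2) s).mul (((D1 s).pow 2).add
      (((D2 s).add (((D1 s).div (hasDerivAt_id s) hs.ne').const_mul p)).pow 2))
    refine h1.congr_deriv ?_
    have e : g2 s = - g s - (n+2) * g1 s / s := by
      have := ode s; field_simp; linarith
    simp only [Pi.add_apply, Pi.pow_apply, Pi.div_apply, id, e]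
    have e1 : (n + 2 - 1) = n + 1 := by omega
    rw [e1, hq, hp, pow_succ s (n+1)]
    push_cast
    field_simp
    ring
  set K : ℝ → ℝ := fun s => E s * Real.exp (q / s)
  have DK : ∀ s, 0 < s → HasDerivAt K
      ((s ^ (n + 2) * (2 * q / s ^ 2 * (g s * (g1 s + p * (g s / s))))) * Real.exp (q / s)
        + E s * (Real.exp (q / s) * (-(q / s ^ 2)))) s := by
    intro s hs
    have h2 : HasDerivAt (fun s : ℝ => q / s) (-(q / s ^ 2)) s := by
      have := (hasDerivAt_inv hs.ne').const_mul q
      refine this.congr_deriv ?_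
      ring
    exact (DE s hs).mul h2.exp
  have anti : AntitoneOn K (Set.Ici 1) := by
    refine antitoneOn_of_deriv_nonpos (convex_Ici 1) ?_ ?_ ?_
    · exact fun s hs => (DK s (lt_of_lt_of_le one_pos hs)).continuousAt.continuousWithinAt
    · intro s hs
      rw [interior_Ici] at hs
      exact (DK s (one_pos.trans hs)).differentiableAt.differentiableWithinAt
    · intro s hs
      rw [interior_Ici] at hs
      have hs0 : 0 < s := one_pos.trans hs
      rw [(DK s hs0).deriv]
      have : (s ^ (n + 2) * (2 * q / s ^ 2 * (g s * (g1 s + p * (g s / s))))) * Real.exp (q / s)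
        + E s * (Real.exp (q / s) * (-(q / s ^ 2))) =
        - (s ^ (n+2) * Real.exp (q / s) * (q / s ^ 2) * (g s - (g1 s + p * (g s / s))) ^ 2) := by
        simp only [hE]; ring
      rw [this, neg_nonpos]
      positivity
  have bnd : ∀ s, |g s| ≤ ∫ t in (-1:ℝ)..1, |huw n t| := by
    intro s
    rw [← Real.norm_eq_abs]
    refine intervalIntegral.norm_integral_le_of_norm_le (by norm_num) ?_
      ((by fun_prop : Continuous _).intervalIntegrable _ _)
    refine Eventually.of_forall fun t _ => ?_
    rw [Real.norm_eq_abs, abs_mul]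
    exact mul_le_of_le_one_right (abs_nonneg _) (Real.abs_cos_le_one _)
  set M := ∫ t in (-1:ℝ)..1, |huw n t|
  refine ⟨max (M ^ 2) (K 1), le_max_of_le_left (sq_nonneg _), fun s hs => ?_⟩
  rcases le_total s 1 with h | h
  · refine le_max_of_le_left ?_
    calc s ^ (n+2) * g s ^ 2 ≤ 1 * M ^ 2 := by
          have hb : g s ^ 2 ≤ M ^ 2 := by rw [← sq_abs]; gcongr; exact bnd s
          exact mul_le_mul (pow_le_one₀ hs.le h) hb (sq_nonneg _) zero_le_one
      _ = _ := one_mul _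
  · refine le_max_of_le_right ?_
    have hK := anti (Set.mem_Ici.2 le_rfl) (Set.mem_Ici.2 h) h
    refine le_trans ?_ hK
    have e1 : 1 ≤ Real.exp (q / s) := Real.one_le_exp (by positivity)
    have e2 : s ^ (n+2) * g s ^ 2 ≤ E s := by
      simp only [hE]; gcongr; exact le_add_of_nonneg_right (sq_nonneg _)
    have e3 : 0 ≤ E s := by simp only [hE]; positivity
    calc _ ≤ E s := e2
      _ ≤ K s := le_mul_of_one_le_right e3 e1

lemma hu_section_volume (n : ℕ) (t : ℝ) (ht : t ∈ Set.Icc (-1:ℝ) 1) :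
    volume.real {y : Fin n → ℝ | t ^ 2 + ∑ i, y i ^ 2 ≤ 1} =
      huw n t * volume.real (Metric.ball (0 : EuclideanSpace ℝ (Fin n)) 1) := by
  have hpos : 0 ≤ 1 - t ^ 2 := by nlinarith [ht.1, ht.2]
  have h1 : {y : Fin n → ℝ | t ^ 2 + ∑ i, y i ^ 2 ≤ 1} =
      (WithLp.toLp 2) ⁻¹' (Metric.closedBall (0 : EuclideanSpace ℝ (Fin n)) (√(1 - t ^ 2))) := by
    ext y
    simp only [Set.mem_ofPred_eq, Set.mem_preimage, mem_closedBall_zero_iff]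
    rw [EuclideanSpace.norm_eq, Real.sqrt_le_sqrt_iff hpos]
    simp only [Real.norm_eq_abs, sq_abs]
    constructor <;> intro h <;> linarith
  rw [measureReal_def, h1, (PiLp.volume_preserving_toLp (Fin n)).measure_preimage
    measurableSet_closedBall.nullMeasurableSet,
    Measure.addHaar_closedBall _ _ (Real.sqrt_nonneg _), ENNReal.toReal_mul,
    ENNReal.toReal_ofReal (by positivity)]
  simp [huw, measureReal_def]

lemma hu_slice (n : ℕ) (e : EuclideanSpace ℝ (Fin (n+1))) (he : ‖e‖ = 1) (φ : ℝ → ℂ)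
    (hφ : Continuous φ) :
    ∫ y in Metric.closedBall (0 : EuclideanSpace ℝ (Fin (n+1))) 1, φ (inner ℝ e y) =
      (volume.real (Metric.ball (0 : EuclideanSpace ℝ (Fin n)) 1) : ℂ) *
        ∫ t in (-1:ℝ)..1, (huw n t : ℂ) * φ t := by
  obtain ⟨b, hb⟩ := Orthonormal.exists_orthonormalBasis_extension_of_card_eq
    (𝕜 := ℝ) (E := EuclideanSpace ℝ (Fin (n+1))) (ι := Fin (n+1)) (by simp)
    (v := fun _ => e) (s := {0}) (by
      constructor
      · intro i; simpa using he
      · intro i j hij; exact absurd (Subsingleton.elim i j) hij)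
  have hb0 : b 0 = e := hb 0 (by simp)
  set S : Set (ℝ × (Fin n → ℝ)) := {p | p.1 ^ 2 + ∑ i, p.2 i ^ 2 ≤ 1} with hS
  have hSm : MeasurableSet S := by
    apply measurableSet_le <;> fun_prop
  let G : ℝ × (Fin n → ℝ) → ℂ := S.indicator (fun p => φ p.1)
  let Φ : EuclideanSpace ℝ (Fin (n+1)) → ℝ × (Fin n → ℝ) := fun y =>
    MeasurableEquiv.piFinSuccAbove (fun _ => ℝ) 0 (WithLp.ofLp (b.repr y))
  have hΦ : MeasurePreserving Φ volume volume :=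
    ((volume_preserving_piFinSuccAbove (fun _ : Fin (n+1) => ℝ) 0).comp
      (PiLp.volume_preserving_ofLp (Fin (n+1)))).comp b.measurePreserving_repr
  have hΦe : MeasurableEmbedding Φ :=
    (((b.repr.toHomeomorph.toMeasurableEquiv).trans
      (MeasurableEquiv.toLp 2 (Fin (n+1) → ℝ)).symm).trans
      (MeasurableEquiv.piFinSuccAbove (fun _ => ℝ) 0)).measurableEmbedding
  have key : ∀ y, (Metric.closedBall (0 : EuclideanSpace ℝ (Fin (n+1))) 1).indicator
      (fun y => φ (inner ℝ e y)) y = G (Φ y) := by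
    intro y
    have h1 : (Φ y).1 = inner ℝ e y := by
      rw [← hb0, ← b.repr_apply_apply]; rfl
    have h2 : y ∈ Metric.closedBall (0 : EuclideanSpace ℝ (Fin (n+1))) 1 ↔ Φ y ∈ S := by
      rw [mem_closedBall_zero_iff, ← b.repr.norm_map, EuclideanSpace.norm_eq, Real.sqrt_le_one,
        Fin.sum_univ_succ]
      simp only [Real.norm_eq_abs, sq_abs]
      rfl
    by_cases hy : Φ y ∈ S
    · simp only [G]
      rw [Set.indicator_of_mem hy, Set.indicator_of_mem (h2.2 hy), h1]
    · simp only [G]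
      rw [Set.indicator_of_notMem hy, Set.indicator_of_notMem (fun h => hy (h2.1 h))]
  have hint : Integrable G volume := by
    rw [← hΦ.integrable_comp_emb hΦe]
    have : G ∘ Φ = (Metric.closedBall (0 : EuclideanSpace ℝ (Fin (n+1))) 1).indicator
      (fun y => φ (inner ℝ e y)) := by ext y; exact (key y).symm
    rw [this, integrable_indicator_iff measurableSet_closedBall]
    exact (by fun_prop : Continuous fun y => φ (inner ℝ e y)).continuousOn.integrableOn_compact
      (isCompact_closedBall _ _)
  rw [← integral_indicator measurableSet_closedBall]
  simp_rw [key]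
  rw [hΦ.integral_comp hΦe G, Measure.volume_eq_prod, integral_prod _ hint]
  have inner : ∀ t, ∫ y, G (t, y) = (Set.Icc (-1:ℝ) 1).indicator
      (fun t => (volume.real (Metric.ball (0 : EuclideanSpace ℝ (Fin n)) 1) : ℂ) *
        ((huw n t : ℂ) * φ t)) t := by
    intro t
    have : ∀ y, G (t, y) = {y : Fin n → ℝ | t ^ 2 + ∑ i, y i ^ 2 ≤ 1}.indicator
      (fun _ => φ t) y := fun y => rfl
    simp_rw [this]
    rw [integral_indicator_const _ (by apply measurableSet_le <;> fun_prop)]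
    by_cases ht : t ∈ Set.Icc (-1:ℝ) 1
    · rw [Set.indicator_of_mem ht, hu_section_volume n t ht, Complex.real_smul]
      push_cast; ring
    · rw [Set.indicator_of_notMem ht]
      have : {y : Fin n → ℝ | t ^ 2 + ∑ i, y i ^ 2 ≤ 1} = ∅ := by
        rw [Set.eq_empty_iff_forall_notMem]
        intro y hy
        apply ht
        have h0 : 0 ≤ ∑ i, y i ^ 2 := Finset.sum_nonneg fun i _ => sq_nonneg _
        have : t ^ 2 ≤ 1 := by
          have : t ^ 2 + ∑ i, y i ^ 2 ≤ 1 := hy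
          linarith
        exact abs_le.1 ((sq_le_one_iff_abs_le_one t).1 this)
      rw [this]; simp
  simp_rw [inner]
  rw [integral_indicator measurableSet_Icc, integral_const_mul, integral_Icc_eq_integral_Ioc,
    intervalIntegral.integral_of_le (by norm_num)]

lemma hu_exp_cos (n : ℕ) (s : ℝ) :
    ∫ t in (-1:ℝ)..1, (huw n t : ℂ) * Complex.exp (-(s * t : ℝ) * Complex.I) =
      ((∫ t in (-1:ℝ)..1, huw n t * Real.cos (s * t) : ℝ) : ℂ) := by
  have hc := huw_cont n
  have h0 : ∫ t in (-1:ℝ)..1, huw n t * Real.sin (s * t) = 0 := by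
    have h := intervalIntegral.integral_comp_neg (a := -1) (b := 1)
      (fun t => huw n t * Real.sin (s * t))
    have h2 : ∀ t, huw n (-t) * Real.sin (s * -t) = - (huw n t * Real.sin (s * t)) := by
      intro t; rw [mul_neg, Real.sin_neg]; simp [huw]
    simp only [h2, intervalIntegral.integral_neg, neg_neg] at h
    linarith
  have h1 : ∀ t : ℝ, (huw n t : ℂ) * Complex.exp (-(s * t : ℝ) * Complex.I) =
      ((huw n t * Real.cos (s * t) : ℝ) : ℂ) - ((huw n t * Real.sin (s * t) : ℝ) : ℂ) * Complex.I := by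
    intro t
    rw [Complex.exp_mul_I, ← Complex.ofReal_neg, ← Complex.ofReal_cos, ← Complex.ofReal_sin,
      Real.cos_neg, Real.sin_neg]
    push_cast; ring
  simp_rw [h1]
  rw [intervalIntegral.integral_sub, intervalIntegral.integral_mul_const,
    intervalIntegral.integral_ofReal, intervalIntegral.integral_ofReal, h0]
  · simp
  all_goals exact (by fun_prop : Continuous _).intervalIntegrable _ _

lemma hu_ball_decay (n : ℕ) : ∃ C : ℝ, 0 ≤ C ∧ ∀ r : ℝ, 0 < r →
    ∀ ξ : EuclideanSpace ℝ (Fin (n+1)), ξ ≠ 0 →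
    ‖∫ y in Metric.closedBall (0 : EuclideanSpace ℝ (Fin (n+1))) r,
      Complex.exp (-(2 * Real.pi * inner ℝ ξ y : ℝ) * Complex.I)‖ ^ 2 ≤
      C * r ^ n * (‖ξ‖⁻¹) ^ (n + 2) := by
  obtain ⟨C, hC, h⟩ := hu_decay1 n
  set κ := volume.real (Metric.ball (0 : EuclideanSpace ℝ (Fin n)) 1)
  refine ⟨κ ^ 2 * C * ((2 * Real.pi)⁻¹) ^ (n+2), by positivity, fun r hr ξ hξ => ?_⟩
  have hξ0 : 0 < ‖ξ‖ := norm_pos_iff.2 hξ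
  set e := ‖ξ‖⁻¹ • ξ with he
  have hen : ‖e‖ = 1 := by rw [he, norm_smul, norm_inv, norm_norm, inv_mul_cancel₀ hξ0.ne']
  set s := 2 * Real.pi * r * ‖ξ‖ with hs
  have hs0 : 0 < s := by positivity
  have hsc := Measure.setIntegral_comp_smul_of_pos (volume : Measure (EuclideanSpace ℝ (Fin (n+1))))
    (fun y => Complex.exp (-(2 * Real.pi * inner ℝ ξ y : ℝ) * Complex.I))
    (Metric.closedBall 0 1) hr
  rw [smul_closedBall _ _ zero_le_one] at hsc
  simp only [smul_zero, Real.norm_eq_abs, abs_of_pos hr, mul_one, finrank_euclideanSpace,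
    Fintype.card_fin] at hsc
  have e1 : ∀ y : EuclideanSpace ℝ (Fin (n+1)),
      Complex.exp (-(2 * Real.pi * inner ℝ ξ (r • y) : ℝ) * Complex.I) =
      (fun t : ℝ => Complex.exp (-(s * t : ℝ) * Complex.I)) (inner ℝ e y) := by
    intro y
    have : 2 * Real.pi * inner ℝ ξ (r • y) = s * inner ℝ e y := by
      rw [he, inner_smul_left, inner_smul_right, hs]
      simp; field_simp
    simp only [this]
  simp_rw [e1] at hsc
  rw [hu_slice n e hen (fun t : ℝ => Complex.exp (-(s * t : ℝ) * Complex.I)) (by fun_prop),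
    hu_exp_cos] at hsc
  have h2 := h s hs0
  set g := ∫ t in (-1:ℝ)..1, huw n t * Real.cos (s * t)
  set J := ∫ y in Metric.closedBall (0 : EuclideanSpace ℝ (Fin (n+1))) r,
      Complex.exp (-(2 * Real.pi * inner ℝ ξ y : ℝ) * Complex.I)
  have hJ : J = ((r ^ (n+1) * (κ * g) : ℝ) : ℂ) := by
    push_cast
    rw [show (κ : ℂ) * g = _ from hsc, Complex.real_smul]
    push_cast
    rw [← mul_assoc, mul_inv_cancel₀, one_mul]
    exact pow_ne_zero _ (by exact_mod_cast hr.ne')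
  rw [hJ, Complex.norm_real, Real.norm_eq_abs, sq_abs]
  have hg : g ^ 2 ≤ C * (s⁻¹) ^ (n+2) := by
    rw [inv_pow, ← div_eq_mul_inv, le_div_iff₀ (by positivity)]; linarith
  calc (r ^ (n+1) * (κ * g)) ^ 2 = r ^ (2 * n + 2) * κ ^ 2 * g ^ 2 := by ring
    _ ≤ r ^ (2 * n + 2) * κ ^ 2 * (C * (s⁻¹) ^ (n+2)) := by gcongr
    _ = _ := by
      rw [hs, mul_inv, mul_inv, mul_pow, mul_pow]
      have : r ^ (2 * n + 2) * (r⁻¹) ^ (n+2) = r ^ n := by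
        rw [show 2 * n + 2 = n + (n + 2) by ring, pow_add r n, mul_assoc, ← mul_pow,
          mul_inv_cancel₀ hr.ne', one_pow, mul_one]
      rw [← this]; ring

/-- Parseval on the unit cube -/
lemma hu_parseval (d : ℕ) (F : (Fin d → ℝ) → ℝ) (hF : Measurable F) (M : ℝ)
    (hM : ∀ x, |F x| ≤ M) :
    HasSum (fun k : Fin d → ℤ =>
      ‖∫ x in {x : Fin d → ℝ | ∀ i, x i ∈ Set.Ioc (0:ℝ) 1},
        Complex.exp (-(2 * Real.pi * ∑ i, k i * x i : ℝ) * Complex.I) * (F x : ℂ)‖ ^ 2)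
      (∫ x in {x : Fin d → ℝ | ∀ i, x i ∈ Set.Ioc (0:ℝ) 1}, F x ^ 2) := by
  letI huMS : MeasureSpace UnitAddCircle := ⟨AddCircle.haarAddCircle⟩
  haveI huProb : IsProbabilityMeasure (volume : Measure UnitAddCircle) :=
    inferInstanceAs (IsProbabilityMeasure AddCircle.haarAddCircle)
  let rep : UnitAddTorus (Fin d) → (Fin d → ℝ) := fun θ i => (AddCircle.equivIoc 1 0 (θ i)).1
  have hrep : Measurable rep := by
    refine measurable_pi_lambda _ fun i => ?_
    exact measurable_subtype_coe.comp
      ((AddCircle.measurableEquivIoc 1 0).measurable.comp (measurable_pi_apply i))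
  let f : UnitAddTorus (Fin d) → ℂ := fun θ => (F (rep θ) : ℂ)
  have hfm : Measurable f := Complex.measurable_ofReal.comp (hF.comp hrep)
  have hf : MemLp f 2 (volume : Measure (UnitAddTorus (Fin d))) :=
    MemLp.of_bound hfm.aestronglyMeasurable M (Eventually.of_forall fun θ => by
      simpa [f] using hM (rep θ))
  have hQ : MeasurableSet {x : Fin d → ℝ | ∀ i, x i ∈ Set.Ioc (0:ℝ) (0 + 1)} :=
    MeasurableSet.univ_pi' fun i => measurableSet_Ioc
  have hrepc : ∀ x ∈ {x : Fin d → ℝ | ∀ i, x i ∈ Set.Ioc (0:ℝ) (0 + 1)},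
      f (fun i => (x i : UnitAddCircle)) = (F x : ℂ) := by
    intro x hx
    have : rep (fun i => (x i : UnitAddCircle)) = x := by
      funext i
      exact congrArg Subtype.val (AddCircle.equivIoc_coe_eq (hx i))
    simp only [f, this]
  have hS := UnitAddTorus.hasSum_sq_mFourierCoeff (hf.toLp f)
  have hcoe := hf.coeFn_toLp
  have e1 : ∀ k : Fin d → ℤ, UnitAddTorus.mFourierCoeff (hf.toLp f) k =
      ∫ x in {x : Fin d → ℝ | ∀ i, x i ∈ Set.Ioc (0:ℝ) (0 + 1)},
        Complex.exp (-(2 * Real.pi * ∑ i, k i * x i : ℝ) * Complex.I) * (F x : ℂ) := by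
    intro k
    have : UnitAddTorus.mFourierCoeff (hf.toLp f) k = UnitAddTorus.mFourierCoeff f k := by
      unfold UnitAddTorus.mFourierCoeff
      refine integral_congr_ae ?_
      filter_upwards [hcoe] with θ hθ
      rw [hθ]
    rw [this, UnitAddTorus.mFourierCoeff_eq_integral f k (fun _ => 0)]
    refine setIntegral_congr_fun hQ fun x hx => ?_
    simp only [smul_eq_mul]
    rw [hrepc x hx]
    congr 1
    simp only [UnitAddTorus.mFourier, ContinuousMap.coe_mk, fourier_coe_apply, Pi.neg_apply]
    rw [← Complex.exp_sum]
    congr 1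
    push_cast
    rw [Finset.mul_sum, ← Finset.sum_neg_distrib, Finset.sum_mul]
    refine Finset.sum_congr rfl fun i _ => ?_
    ring
  have e2 : ∫ θ, ‖(hf.toLp f) θ‖ ^ 2 =
      ∫ x in {x : Fin d → ℝ | ∀ i, x i ∈ Set.Ioc (0:ℝ) (0 + 1)}, F x ^ 2 := by
    have : ∫ θ, ‖(hf.toLp f) θ‖ ^ 2 = ∫ θ, ‖f θ‖ ^ 2 := by
      refine integral_congr_ae ?_
      filter_upwards [hcoe] with θ hθ
      rw [hθ]
    rw [this, UnitAddTorus.integral_preimage _ (fun _ => 0)]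
    refine setIntegral_congr_fun hQ fun x hx => ?_
    show ‖f (fun i => (x i : UnitAddCircle))‖ ^ 2 = _
    rw [hrepc x hx, Complex.norm_real, Real.norm_eq_abs, sq_abs]
  rw [e2] at hS
  simp only [e1, zero_add] at hS
  exact hS


lemma hu_summable (d : ℕ) (m : ℕ) (hm : d < m) :
    Summable fun k : Fin d → ℤ => (‖k‖⁻¹) ^ m := by
  let b := Pi.basisFun ℝ (Fin d)
  have h := ZLattice.summable_norm_pow_inv (Submodule.span ℤ (Set.range b)) m
    (by rw [ZLattice.rank ℝ]; simpa using hm)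
  let e : (Fin d → ℤ) → Submodule.span ℤ (Set.range b) := fun k =>
    ⟨fun i => (k i : ℝ), by
      rw [Module.Basis.mem_span_iff_repr_mem]
      intro i; simp [b]⟩
  have he : Function.Injective e := by
    intro k k' h
    funext i
    have := congrFun (congrArg Subtype.val h) i
    simpa [e] using this
  refine (h.comp_injective he).congr fun k => ?_
  simp only [Function.comp]
  congr 2

/-- the half-open unit cube -/
def huQ (d : ℕ) : Set (Fin d → ℝ) := {x : Fin d → ℝ | ∀ i, x i ∈ Set.Ioc (0:ℝ) 1}

lemma huQ_meas (d : ℕ) : MeasurableSet (huQ d) :=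
  MeasurableSet.univ_pi' fun i => measurableSet_Ioc

lemma huQ_eq (d : ℕ) : huQ d = Set.pi Set.univ fun _ => Set.Ioc (0:ℝ) 1 := by
  ext x; simp [huQ]

lemma huQ_volume (d : ℕ) : volume (huQ d) = 1 := by
  rw [huQ_eq, Real.volume_pi_Ioc]; simp

/-- an integer vector as a real vector -/
def huZ {d : ℕ} (m : Fin d → ℤ) : Fin d → ℝ := fun i => (m i : ℝ)

/-- unfolding -/
lemma hu_unfold (d : ℕ) (g : (Fin d → ℝ) → ℂ) (hg : Integrable g) (S : Finset (Fin d → ℤ))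
    (hS : ∀ m ∉ S, ∀ x ∈ huQ d, g (huZ m + x) = 0) :
    ∑ m ∈ S, ∫ x in huQ d, g (huZ m + x) = ∫ x, g x := by
  let T : (Fin d → ℤ) → Set (Fin d → ℝ) := fun m => (fun y => -huZ m + y) ⁻¹' huQ d
  have hT : ∀ m, MeasurableSet (T m) := fun m => (huQ_meas d).preimage (by fun_prop)
  have h1 : ∀ m, ∫ x in huQ d, g (huZ m + x) = ∫ y in T m, g y := by
    intro m
    have := (measurePreserving_add_left (volume : Measure (Fin d → ℝ)) (-huZ m)
      ).setIntegral_preimage_emb (measurableEmbedding_addLeft _) (fun x => g (huZ m + x)) (huQ d)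
    rw [← this]
    refine setIntegral_congr_fun (hT m) fun y _ => ?_
    simp
  simp_rw [h1]
  rw [← integral_biUnion_finset S (fun m _ => hT m) ?_ (fun m _ => hg.integrableOn)]
  · refine setIntegral_eq_integral_of_forall_compl_eq_zero fun y hy => ?_
    let m : Fin d → ℤ := fun i => ⌈y i⌉ - 1
    have hm : -huZ m + y ∈ huQ d := by
      intro i
      simp only [huZ, m, Pi.add_apply, Pi.neg_apply]
      push_cast
      have h1 := Int.le_ceil (y i)
      have h2 := Int.ceil_lt_add_one (y i)
      constructor <;> linarith
    have hmS : m ∉ S := fun h => hy (Set.mem_biUnion h hm)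
    have := hS m hmS _ hm
    simpa using this
  · intro m _ m' _ hne
    refine Set.disjoint_left.2 fun y hy hy' => hne ?_
    funext i
    have h1 := hy i
    have h2 := hy' i
    simp only [huZ, Pi.add_apply, Pi.neg_apply] at h1 h2
    have h3 : (m i : ℝ) < m' i + 1 := by linarith [h1.1, h2.2]
    have h4 : (m' i : ℝ) < m i + 1 := by linarith [h2.1, h1.2]
    have h3' : m i < m' i + 1 := by exact_mod_cast h3
    have h4' : m' i < m i + 1 := by exact_mod_cast h4
    omega

/-- the counting function as a finite sum -/
def huF {d : ℕ} (e : EuclideanSpace ℝ (Fin d) ≃L[ℝ] (Fin d → ℝ)) (S : Finset (Fin d → ℤ)) (r : ℝ)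
    (t : Fin d → ℝ) : ℝ :=
  ∑ m ∈ S, (Metric.closedBall (0 : EuclideanSpace ℝ (Fin d)) r).indicator (fun _ => (1:ℝ))
    (e.symm (huZ m + t))

def huCov {d : ℕ} (e : EuclideanSpace ℝ (Fin d) ≃L[ℝ] (Fin d → ℝ)) (S : Finset (Fin d → ℤ)) (r : ℝ) :
    Prop := ∀ m ∉ S, ∀ x : Fin d → ℝ, (∀ i, x i ∈ Set.Icc (0:ℝ) 1) →
      e.symm (huZ m + x) ∉ Metric.closedBall (0 : EuclideanSpace ℝ (Fin d)) r

lemma huF_meas {d : ℕ} (e : EuclideanSpace ℝ (Fin d) ≃L[ℝ] (Fin d → ℝ)) (S : Finset (Fin d → ℤ))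
    (r : ℝ) : Measurable (huF e S r) := by
  unfold huF
  refine Finset.measurable_sum _ fun m _ => ?_
  exact (measurable_const.indicator measurableSet_closedBall).comp (by fun_prop)

lemma huF_bound {d : ℕ} (e : EuclideanSpace ℝ (Fin d) ≃L[ℝ] (Fin d → ℝ)) (S : Finset (Fin d → ℤ))
    (r : ℝ) (t : Fin d → ℝ) : |huF e S r t| ≤ S.card := by
  unfold huF
  refine (Finset.abs_sum_le_sum_abs _ _).trans ?_
  refine (Finset.sum_le_card_nsmul _ _ 1 fun m _ => ?_).trans (by simp)
  unfold Set.indicator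
  split_ifs <;> simp

lemma hu_haar {d : ℕ} (e : EuclideanSpace ℝ (Fin d) ≃L[ℝ] (Fin d → ℝ)) :
    ∃ c : NNReal, c ≠ 0 ∧ Measure.map e volume = c • (volume : Measure (Fin d → ℝ)) := by
  have h := Measure.isAddLeftInvariant_eq_smul (Measure.map e volume)
    (volume : Measure (Fin d → ℝ))
  refine ⟨_, ?_, h⟩
  intro h0
  rw [h0, zero_smul] at h
  exact (NeZero.ne (Measure.map e (volume : Measure (EuclideanSpace ℝ (Fin d))))) h

lemma hu_coef {n : ℕ} (e : EuclideanSpace ℝ (Fin (n+1)) ≃L[ℝ] (Fin (n+1) → ℝ)) :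
    ∃ C : ℝ, 0 ≤ C ∧ ∀ r : ℝ, 0 < r → ∀ S, huCov e S r → ∀ k : Fin (n+1) → ℤ, k ≠ 0 →
    ‖∫ x in huQ (n+1),
        Complex.exp (-(2 * Real.pi * ∑ i, k i * x i : ℝ) * Complex.I) * (huF e S r x : ℂ)‖ ^ 2
      ≤ C * r ^ n * (‖k‖⁻¹) ^ (n + 2) := by
  obtain ⟨C, hC, hdec⟩ := hu_ball_decay n
  obtain ⟨c, hc0, hc⟩ := hu_haar e
  set K : ℝ := ∑ i, ‖e.symm (Pi.single i 1)‖ with hK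
  have hK0 : 0 ≤ K := Finset.sum_nonneg fun i _ => norm_nonneg _
  have hcpos : 0 < (c : ℝ) := by positivity
  refine ⟨((c:ℝ)⁻¹) ^ 2 * C * K ^ (n+2), by positivity, fun r hr S hS k hk => ?_⟩
  let ξ : EuclideanSpace ℝ (Fin (n+1)) := (InnerProductSpace.toDual ℝ _).symm
    ((∑ i, (k i : ℝ) • (ContinuousLinearMap.proj i : (Fin (n+1) → ℝ) →L[ℝ] ℝ)).comp
      (e : EuclideanSpace ℝ (Fin (n+1)) →L[ℝ] (Fin (n+1) → ℝ)))
  have hξ : ∀ y, inner ℝ ξ y = ∑ i, (k i : ℝ) * e y i := by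
    intro y
    simp only [ξ, InnerProductSpace.toDual_symm_apply]
    simp
  have hkξ : ‖k‖ ≤ K * ‖ξ‖ := by
    refine (pi_norm_le_iff_of_nonneg (by positivity)).2 fun i => ?_
    have h1 : inner ℝ ξ (e.symm (Pi.single i 1)) = (k i : ℝ) := by
      rw [hξ]; simp [Pi.single_apply]
    have h2 : ‖k i‖ = |inner ℝ ξ (e.symm (Pi.single i 1))| := by
      rw [h1]; simp [Int.norm_eq_abs]
    rw [h2, mul_comm]
    refine (abs_real_inner_le_norm _ _).trans ?_
    gcongr
    exact Finset.single_le_sum (f := fun i => ‖e.symm (Pi.single i 1)‖)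
      (fun i _ => norm_nonneg _) (Finset.mem_univ i)
  have hk0 : 0 < ‖k‖ := norm_pos_iff.2 hk
  have hξ0 : ξ ≠ 0 := by
    intro h; rw [h, norm_zero, mul_zero] at hkξ; linarith
  have hξpos : 0 < ‖ξ‖ := norm_pos_iff.2 hξ0
  set B := Metric.closedBall (0 : EuclideanSpace ℝ (Fin (n+1))) r with hB
  let E : (Fin (n+1) → ℝ) → ℂ := fun x =>
    Complex.exp (-(2 * Real.pi * ∑ i, k i * x i : ℝ) * Complex.I)
  have hEc : Continuous E := by fun_prop
  let g : (Fin (n+1) → ℝ) → ℂ := (e.symm ⁻¹' B).indicator E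
  have hBm : MeasurableSet (e.symm ⁻¹' B) :=
    measurableSet_closedBall.preimage (by fun_prop)
  have hgint : Integrable g := by
    rw [integrable_indicator_iff hBm]
    refine hEc.continuousOn.integrableOn_compact ?_
    exact e.symm.toHomeomorph.isClosedEmbedding.isCompact_preimage (isCompact_closedBall _ _)
  have hper : ∀ m x, E (huZ m + x) = E x := by
    intro m x
    simp only [E]
    rw [Complex.exp_eq_exp_iff_exists_int]
    refine ⟨-∑ i, k i * m i, ?_⟩
    simp only [huZ, Pi.add_apply, mul_add, Finset.sum_add_distrib]
    push_cast
    ring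
  have hgm : ∀ m x, g (huZ m + x) = E x *
      ((B.indicator (fun _ => (1:ℝ)) (e.symm (huZ m + x)) : ℝ) : ℂ) := by
    intro m x
    by_cases h : e.symm (huZ m + x) ∈ B
    · simp only [g]
      rw [Set.indicator_of_mem (show huZ m + x ∈ e.symm ⁻¹' B from h), Set.indicator_of_mem h, hper]
      simp
    · simp only [g]
      rw [Set.indicator_of_notMem (show huZ m + x ∉ e.symm ⁻¹' B from h),
        Set.indicator_of_notMem h]
      simp
  have hco : ∫ x in huQ (n+1), E x * (huF e S r x : ℂ) = ∫ x, g x := by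
    rw [← hu_unfold (n+1) g hgint S]
    · rw [← integral_finset_sum]
      · refine setIntegral_congr_fun (huQ_meas _) fun x _ => ?_
        simp only [hgm, huF]
        push_cast
        rw [Finset.mul_sum]
      · intro m _
        exact (hgint.comp_add_left (huZ m)).integrableOn
    · intro m hm x hx
      have := hS m hm x (fun i => Set.Ioc_subset_Icc_self (hx i))
      exact Set.indicator_of_notMem (show huZ m + x ∉ e.symm ⁻¹' B from this) _
  have hchange : ∫ y in B, Complex.exp (-(2 * Real.pi * inner ℝ ξ y : ℝ) * Complex.I) =
      (c : ℂ) * ∫ x, g x := by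
    have h1 : ∫ x, g x ∂(Measure.map e volume) = ∫ y, g (e y) :=
      e.toHomeomorph.measurableEmbedding.integral_map g
    rw [hc, integral_smul_nnreal_measure] at h1
    have h2 : ∀ y, g (e y) = B.indicator
      (fun y => Complex.exp (-(2 * Real.pi * inner ℝ ξ y : ℝ) * Complex.I)) y := by
      intro y
      by_cases h : y ∈ B
      · simp only [g]
        rw [Set.indicator_of_mem (by simpa using h), Set.indicator_of_mem h, hξ]
      · simp only [g]
        rw [Set.indicator_of_notMem (by simpa using h), Set.indicator_of_notMem h]
    simp_rw [h2] at h1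
    rw [integral_indicator measurableSet_closedBall] at h1
    rw [← h1, NNReal.smul_def, Complex.real_smul]
  have hd := hdec r hr ξ hξ0
  rw [hchange, norm_mul, mul_pow] at hd
  rw [hco]
  have hcn : ‖(c:ℂ)‖ = (c:ℝ) := by
    simp
  rw [hcn] at hd
  have hinv : ‖ξ‖⁻¹ ≤ K * ‖k‖⁻¹ := by
    rw [inv_eq_one_div, div_le_iff₀ hξpos, mul_assoc, mul_comm ‖k‖⁻¹, ← mul_assoc,
      ← div_eq_mul_inv, le_div_iff₀ hk0]
    linarith
  have hgoal : ‖∫ x, g x‖ ^ 2 ≤ ((c:ℝ)⁻¹) ^ 2 * (C * r ^ n * (‖ξ‖⁻¹) ^ (n + 2)) := by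
    rw [inv_pow, inv_mul_eq_div, le_div_iff₀ (by positivity)]
    linarith
  refine hgoal.trans ?_
  calc ((c:ℝ)⁻¹) ^ 2 * (C * r ^ n * (‖ξ‖⁻¹) ^ (n + 2))
      ≤ ((c:ℝ)⁻¹) ^ 2 * (C * r ^ n * (K * ‖k‖⁻¹) ^ (n + 2)) := by gcongr
    _ = _ := by rw [mul_pow]; ring

lemma hu_var {n : ℕ} (e : EuclideanSpace ℝ (Fin (n+1)) ≃L[ℝ] (Fin (n+1) → ℝ)) :
    ∃ C : ℝ, 0 ≤ C ∧ ∀ r : ℝ, 0 < r → ∀ S, huCov e S r →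
      (∫ x in huQ (n+1), huF e S r x ^ 2) - (∫ x in huQ (n+1), huF e S r x) ^ 2 ≤ C * r ^ n := by
  obtain ⟨C, hC, h⟩ := hu_coef e
  have hsum := hu_summable (n+1) (n+2) (by omega)
  refine ⟨C * ∑' k : Fin (n+1) → ℤ, (‖k‖⁻¹) ^ (n+2), ?_, fun r hr S hS => ?_⟩
  · exact mul_nonneg hC (tsum_nonneg fun k => by positivity)
  have hp := hu_parseval (n+1) (huF e S r) (huF_meas e S r) S.card (huF_bound e S r)
  change HasSum (fun k : Fin (n+1) → ℤ =>
      ‖∫ x in huQ (n+1),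
        Complex.exp (-(2 * Real.pi * ∑ i, k i * x i : ℝ) * Complex.I) * (huF e S r x : ℂ)‖ ^ 2)
      (∫ x in huQ (n+1), huF e S r x ^ 2) at hp
  have hp2 := hp.update 0 0
  have hz : ‖∫ x in huQ (n+1),
        Complex.exp (-(2 * Real.pi * ∑ i, ((0 : Fin (n+1) → ℤ) i : ℝ) * x i : ℝ) * Complex.I) *
          (huF e S r x : ℂ)‖ ^ 2 = (∫ x in huQ (n+1), huF e S r x) ^ 2 := by
    have : ∀ x : Fin (n+1) → ℝ, Complex.exp (-(2 * Real.pi *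
        ∑ i, ((0 : Fin (n+1) → ℤ) i : ℝ) * x i : ℝ) * Complex.I) *
          (huF e S r x : ℂ) = (huF e S r x : ℂ) := by
      intro x; simp
    simp_rw [this]
    rw [integral_complex_ofReal, Complex.norm_real, Real.norm_eq_abs, sq_abs]
  rw [hz] at hp2
  have hb := (hsum.hasSum.mul_left (C * r ^ n))
  have := hasSum_le (fun k => ?_) hp2 hb
  · linarith
  · by_cases hk : k = 0
    · subst hk
      rw [Function.update_self]
      positivity
    · rw [Function.update_of_ne hk]
      exact h r hr S hS k hk

theorem statement6
    {Ω : Type*} [MeasurableSpace Ω] (P : Measure Ω) [IsProbabilityMeasure P]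
    (d : ℕ) (hd : 1 ≤ d)
    -- the lattice 𝓛, generated by a basis `a` of ℝ^d
    (a : Fin d → EuclideanSpace ℝ (Fin d))
    (ha : LinearIndependent ℝ a)
    (Lpt : (Fin d → ℤ) → EuclideanSpace ℝ (Fin d))
    (hLpt : ∀ m, Lpt m = ∑ i, (m i : ℝ) • a i)
    -- the fundamental domain 𝒟
    (D : Set (EuclideanSpace ℝ (Fin d)))
    (hD : D = {x | ∃ t : Fin d → ℝ, (∀ i, t i ∈ Set.Ico (0:ℝ) 1) ∧ x = ∑ i, t i • a i})
    -- U uniform on 𝒟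
    (U : Ω → EuclideanSpace ℝ (Fin d))
    (hUmeas : Measurable U)
    (hU : Measure.map U P = (volume D)⁻¹ • volume.restrict D)
    -- the number of points of the stationarized lattice Ξ = 𝓛 + U in the ball B_r
    (N : ℝ → Ω → ℝ)
    (hN : ∀ r ω, N r ω = ∑' m : Fin d → ℤ,
      (Metric.closedBall (0 : EuclideanSpace ℝ (Fin d)) r).indicator (fun _ => (1:ℝ))
        (Lpt m + U ω)) :
    -- Ξ = 𝓛 + U is class I hyperuniform
    (fun r : ℝ =>
      variance (N r) P /
        (volume (Metric.closedBall (0 : EuclideanSpace ℝ (Fin d)) r)).toReal)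
      =O[atTop] (fun r : ℝ => r⁻¹) := by
  obtain ⟨n, rfl⟩ : ∃ n, d = n + 1 := ⟨d - 1, by omega⟩
  let b : Module.Basis (Fin (n+1)) ℝ (EuclideanSpace ℝ (Fin (n+1))) :=
    basisOfLinearIndependentOfCardEqFinrank ha (by simp)
  let e : EuclideanSpace ℝ (Fin (n+1)) ≃L[ℝ] (Fin (n+1) → ℝ) := b.equivFunL
  have hes : ∀ t, e.symm t = ∑ i, t i • a i := by
    intro t
    have : e.symm t = b.equivFun.symm t := rfl
    rw [this, Module.Basis.equivFun_symm_apply]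
    simp [b]
  have heL : ∀ m, e (Lpt m) = huZ m := by
    intro m
    rw [← e.apply_symm_apply (huZ m), hes, hLpt]
    rfl
  -- the domain in coordinates
  let Q0 : Set (Fin (n+1) → ℝ) := Set.pi Set.univ fun _ => Set.Ico (0:ℝ) 1
  have hQ0m : MeasurableSet Q0 := MeasurableSet.univ_pi fun _ => measurableSet_Ico
  have hDQ : D = e ⁻¹' Q0 := by
    rw [hD]
    ext x
    constructor
    · rintro ⟨t, ht, rfl⟩
      rw [← hes]
      simpa [Q0] using ht
    · intro hx
      refine ⟨e x, by simpa [Q0] using hx, ?_⟩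
      rw [← hes, e.symm_apply_apply]
  have hQae : Q0 =ᵐ[volume] huQ (n+1) := by
    rw [huQ_eq]
    exact Measure.univ_pi_Ico_ae_eq_Icc.trans Measure.univ_pi_Ioc_ae_eq_Icc.symm
  obtain ⟨c, hc0, hc⟩ := hu_haar e
  have hem : Measurable e := e.continuous.measurable
  have hDm : MeasurableSet D := by rw [hDQ]; exact hem hQ0m
  have hvolD : volume D = c := by
    rw [hDQ, ← Measure.map_apply hem hQ0m, hc, Measure.smul_apply, measure_congr hQae, huQ_volume]
    simp
  have hτ : Measure.map (fun ω => e (U ω)) P = volume.restrict (huQ (n+1)) := by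
    have h1 : Measure.map (fun ω => e (U ω)) P = Measure.map e (Measure.map U P) :=
      (Measure.map_map hem hUmeas).symm
    rw [h1, hU, Measure.map_smul, hDQ, ← Measure.restrict_map hem hQ0m, ← hDQ, hvolD, hc,
      Measure.restrict_smul, Measure.restrict_congr_set hQae]
    ext s hs
    simp only [Measure.smul_apply, smul_eq_mul, ENNReal.smul_def]
    rw [← mul_assoc, ENNReal.inv_mul_cancel (by simpa using hc0) (by simp), one_mul]
  have hτm : Measurable (fun ω => e (U ω)) := hem.comp hUmeas
  have hprob : IsProbabilityMeasure (volume.restrict (huQ (n+1))) := by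
    rw [← hτ]; exact Measure.isProbabilityMeasure_map hτm.aemeasurable
  have hτQ : ∀ᵐ ω ∂P, e (U ω) ∈ huQ (n+1) := by
    refine ae_of_ae_map (p := fun x => x ∈ huQ (n+1)) hτm.aemeasurable ?_
    rw [hτ]
    exact ae_restrict_mem (huQ_meas _)
  obtain ⟨C, hC, hvar⟩ := hu_var e
  have hmain : ∀ r : ℝ, 0 < r → variance (N r) P ≤ C * r ^ n := by
    intro r hr
    let K : ℤ := ⌈‖(e : EuclideanSpace ℝ (Fin (n+1)) →L[ℝ] (Fin (n+1) → ℝ))‖ * r⌉ + 1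
    let S : Finset (Fin (n+1) → ℤ) := Finset.Icc (fun _ => -K) (fun _ => K)
    have hS : huCov e S r := by
      intro m hm x hx hy
      apply hm
      have hy' : ‖e.symm (huZ m + x)‖ ≤ r := by simpa using hy
      have h1 : ‖huZ m + x‖ ≤
          ‖(e : EuclideanSpace ℝ (Fin (n+1)) →L[ℝ] (Fin (n+1) → ℝ))‖ * r := by
        have := (e : EuclideanSpace ℝ (Fin (n+1)) →L[ℝ] (Fin (n+1) → ℝ)).le_opNorm_of_le hy'
        simpa using this
      have h2 : ∀ i, |(m i : ℝ) + x i| ≤ K - 1 := by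
        intro i
        have h3 := (norm_le_pi_norm (huZ m + x) i).trans h1
        have h4 := h3.trans (Int.le_ceil _)
        simp only [K]
        push_cast
        rw [add_sub_cancel_right]
        exact h4
      rw [Finset.mem_Icc]
      constructor
      · intro i
        have := abs_le.1 (h2 i)
        have hxi := hx i
        have : (-K : ℝ) ≤ m i := by linarith [this.1, hxi.2]
        exact_mod_cast this
      · intro i
        have := abs_le.1 (h2 i)
        have hxi := hx i
        have : (m i : ℝ) ≤ K := by linarith [this.2, hxi.1]
        exact_mod_cast this
    have hNae : N r =ᵐ[P] (huF e S r) ∘ (fun ω => e (U ω)) := by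
      filter_upwards [hτQ] with ω hω
      have hpt : ∀ m, Lpt m + U ω = e.symm (huZ m + e (U ω)) := by
        intro m
        rw [← heL, ← map_add, e.symm_apply_apply]
      rw [hN, tsum_eq_sum (s := S)]
      · simp only [Function.comp, huF, hpt]
      · intro m hm
        rw [hpt]
        exact Set.indicator_of_notMem (hS m hm _ fun i => Set.Ioc_subset_Icc_self (hω i)) _
    have hFm := huF_meas e S r
    rw [variance_congr hNae, ← variance_map hFm.aemeasurable hτm.aemeasurable, hτ,
      variance_eq_sub (MemLp.of_bound hFm.aestronglyMeasurable S.card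
        (Eventually.of_forall fun x => huF_bound e S r x))]
    exact hvar r hr S hS
  set V := volume.real (Metric.ball (0 : EuclideanSpace ℝ (Fin (n+1))) 1) with hV
  have hV0 : 0 < V := ENNReal.toReal_pos (Metric.measure_ball_pos _ _ one_pos).ne'
    measure_ball_lt_top.ne
  refine IsBigO.of_bound (C / V) ?_
  filter_upwards [eventually_gt_atTop 0] with r hr
  have hvolB : (volume (Metric.closedBall (0 : EuclideanSpace ℝ (Fin (n+1))) r)).toReal =
      r ^ (n+1) * V := by
    rw [Measure.addHaar_closedBall _ _ hr.le, ENNReal.toReal_mul,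
      ENNReal.toReal_ofReal (by positivity)]
    simp [hV, measureReal_def]
  rw [hvolB, Real.norm_eq_abs, Real.norm_eq_abs, abs_of_nonneg
    (div_nonneg (variance_nonneg _ _) (by positivity)), abs_of_pos (inv_pos.2 hr)]
  rw [div_le_iff₀ (by positivity)]
  refine (hmain r hr).trans (le_of_eq ?_)
  field_simp
  ring
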